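/- Scaffold duality for translation schemes (main theorem): let (X,R) be a translation association scheme, \(\ell \geq 1\), and let \(\mathsf{S}\) be a weakly connected standard planar scaffold of order \(\ell\) with n nodes whose edge weights lie in \(\{A_0,\dots,A_d\}\). Then \(\Psi(\mathsf{S}) = |X|^{\,n - \ell/2 - 1/2}\, \mathsf{S}^\dagger\), where \(\Psi\) is the linear isometry sending \(\hat{\boldsymbol{\varepsilon}}\) (\(\boldsymbol{\varepsilon}\in\Gamma\)) to \(|X|^{-1/2}\sum_{\Phi(\boldsymbol{\eta})=\boldsymbol{\varepsilon}}\hat{\boldsymbol{\eta}}\), and \(\mathsf{S}^\dagger\) is the dual scaffold, taken with respect to the dual translation scheme \((X^*,R^*)\), on the planar dual digraph with each \(A_i\) replaced by \(E_i^*\). Consequently \(\mathsf{S} \mapsto |X|^{n-\ell/2-1/2}\mathsf{S}^\dagger\) extends to an isometric linear isomorphism from the span of such scaffolds to the span of their duals. -/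

import Mathlib

open scoped ComplexConjugate

section Helpers

open Finset

/-- Boundary map of a digraph with heads `hd` and tails `tl`. -/
noncomputable def scafBdry {V D K : Type*} [Fintype D] [DecidableEq V] [CommGroup K]
    (hd tl : D → V) : (D → K) →* (V → K) where
  toFun f := ∏ e, (Pi.mulSingle (hd e) (f e) / Pi.mulSingle (tl e) (f e))
  map_one' := by simp
  map_mul' f g := by
    simp only [Pi.mul_apply, Pi.mulSingle_mul, ← Finset.prod_mul_distrib]
    refine Finset.prod_congr rfl fun e _ => ?_
    rw [mul_div_mul_comm]

theorem scafBdry_apply {V D K : Type*} [Fintype D] [DecidableEq V] [CommGroup K]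
    (hd tl : D → V) (f : D → K) (v : V) :
    scafBdry hd tl f v = (∏ e ∈ univ.filter fun e => hd e = v, f e) /
      ∏ e ∈ univ.filter fun e => tl e = v, f e := by
  simp only [scafBdry, MonoidHom.coe_mk, OneHom.coe_mk, Finset.prod_apply, Pi.div_apply,
    Pi.mulSingle_apply, Finset.prod_div_distrib, Finset.prod_filter]
  congr 1 <;> exact Finset.prod_congr rfl fun e _ => by simp only [eq_comm]

theorem scafBdry_single {V D K : Type*} [Fintype D] [DecidableEq D] [DecidableEq V] [CommGroup K]
    (hd tl : D → V) (e : D) (a : K) :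
    scafBdry hd tl (Pi.mulSingle e a) = Pi.mulSingle (hd e) a / Pi.mulSingle (tl e) a := by
  simp only [scafBdry, MonoidHom.coe_mk, OneHom.coe_mk]
  rw [Finset.prod_eq_single e]
  · simp
  · intro b _ hb
    simp [Pi.mulSingle_eq_of_ne hb]
  · simp

theorem scaf_ker_card {V D K : Type*} [Fintype D] [DecidableEq D] [Fintype V] [DecidableEq V]
    [CommGroup K] [Finite K] (hd tl : D → V) (v0 : V)
    (hc : ∀ a b : V, Relation.ReflTransGen
      (fun u w => ∃ e, (tl e = u ∧ hd e = w) ∨ (tl e = w ∧ hd e = u)) a b) :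
    Nat.card (scafBdry (K := K) hd tl).ker * Nat.card K ^ Fintype.card V ≤
      Nat.card K ^ Fintype.card D * Nat.card K := by
  set B := scafBdry (K := K) hd tl with hB
  have hpair : ∀ (a : K) (v : V), (Pi.mulSingle v a / Pi.mulSingle v0 a : V → K) ∈ B.range := by
    intro a v
    induction hc v0 v with
    | refl => simp [one_mem]
    | tail _ h ih =>
      rename_i u w _
      have h2 : (Pi.mulSingle w a / Pi.mulSingle u a : V → K) ∈ B.range := by
        obtain ⟨e, ⟨h1, h2⟩ | ⟨h1, h2⟩⟩ := h
        · refine ⟨Pi.mulSingle e a, ?_⟩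
          rw [hB, scafBdry_single, h1, h2]
        · refine ⟨(Pi.mulSingle e a)⁻¹, ?_⟩
          rw [map_inv, hB, scafBdry_single, h1, h2, inv_div]
      have := B.range.mul_mem h2 ih
      rwa [div_mul_div_cancel] at this
  have hall : ∀ g : V → K, g / Pi.mulSingle v0 (∏ v, g v) ∈ B.range := by
    intro g
    have h1 : g / Pi.mulSingle v0 (∏ v, g v) =
        ∏ v, (Pi.mulSingle v (g v) / Pi.mulSingle v0 (g v) : V → K) := by
      rw [Finset.prod_div_distrib, Finset.univ_prod_mulSingle]
      congr 1
      exact map_prod (MonoidHom.mulSingle (fun _ : V => K) v0) _ _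
    rw [h1]
    exact Subgroup.prod_mem _ fun v _ => hpair _ _
  have hle : Nat.card (V → K) ≤ Nat.card (B.range × K) := by
    refine Nat.card_le_card_of_injective
      (fun g : V → K => ((⟨_, hall g⟩ : B.range), ∏ v, g v)) ?_
    intro g g' h
    simp only [Prod.mk.injEq, Subtype.mk.injEq] at h
    obtain ⟨h1, h2⟩ := h
    rw [h2] at h1
    exact div_left_injective h1
  have hkr : Nat.card B.ker * Nat.card B.range = Nat.card (D → K) := by
    rw [← Subgroup.index_ker]
    exact Subgroup.card_mul_index _
  rw [Nat.card_prod, Nat.card_fun, Nat.card_eq_fintype_card (α := V)] at hle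
  rw [Nat.card_fun, Nat.card_eq_fintype_card (α := D)] at hkr
  calc _ ≤ Nat.card B.ker * (Nat.card B.range * Nat.card K) := Nat.mul_le_mul_left _ hle
    _ = _ := by rw [← mul_assoc, hkr]

theorem scaf_charsum {X : Type*} [CommGroup X] [Fintype X] [DecidableEq (X →* ℂˣ)]
    (χ : X →* ℂˣ) :
    ∑ x : X, ((χ x : ℂˣ) : ℂ) = if χ = 1 then (Fintype.card X : ℂ) else 0 := by
  classical
  have h := sum_hom_units ((Units.coeHom ℂ).comp χ)
  simp only [MonoidHom.comp_apply, Units.coeHom_apply] at h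
  rw [h]
  have : (Units.coeHom ℂ).comp χ = 1 ↔ χ = 1 := by
    constructor
    · intro h
      ext x
      have := DFunLike.congr_fun h x
      simpa using this
    · rintro rfl
      ext x
      simp
  simp only [this]
  split_ifs <;> simp

theorem scaf_conj {X : Type*} [CommGroup X] [Fintype X] (χ : X →* ℂˣ) (x : X) :
    conj ((χ x : ℂˣ) : ℂ) = (((χ x)⁻¹ : ℂˣ) : ℂ) := by
  have h : ((χ x : ℂˣ) : ℂ) ^ Fintype.card X = 1 := by
    rw [← Units.val_pow_eq_pow_val, ← map_pow, pow_card_eq_one]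
    simp
  have hn := Complex.norm_eq_one_of_pow_eq_one h Fintype.card_ne_zero
  rw [Units.val_inv_eq_inv_val, Complex.inv_eq_conj hn]

/-- Sum over vertex labelings of the character product. -/
theorem scaf_sigma {X V E L : Type*} [CommGroup X] [Fintype X] [DecidableEq (X →* ℂˣ)]
    [Fintype V] [DecidableEq V] [Fintype E] [Fintype L] (eh et : E → V) (r : L → V)
    (ε : E → (X →* ℂˣ)) (κ : L → (X →* ℂˣ)) :
    ∑ σ : V → X, (∏ e, conj ((ε e (σ (et e)) : ℂˣ) : ℂ) * ((ε e (σ (eh e)) : ℂˣ) : ℂ)) *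
        ∏ i, ((κ i (σ (r i)) : ℂˣ) : ℂ) =
      if (∀ v, (∏ e ∈ univ.filter fun e => et e = v, (ε e)⁻¹) *
          (∏ e ∈ univ.filter fun e => eh e = v, ε e) *
          (∏ i ∈ univ.filter fun i => r i = v, κ i) = 1)
      then (Fintype.card X : ℂ) ^ Fintype.card V else 0 := by
  set χ : V → (X →* ℂˣ) := fun v => (∏ e ∈ univ.filter fun e => et e = v, (ε e)⁻¹) *
          (∏ e ∈ univ.filter fun e => eh e = v, ε e) *
          (∏ i ∈ univ.filter fun i => r i = v, κ i) with hχ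
  have key : ∀ σ : V → X,
      (∏ e, conj ((ε e (σ (et e)) : ℂˣ) : ℂ) * ((ε e (σ (eh e)) : ℂˣ) : ℂ)) *
        ∏ i, ((κ i (σ (r i)) : ℂˣ) : ℂ) = ∏ v, ((χ v (σ v) : ℂˣ) : ℂ) := by
    intro σ
    simp only [scaf_conj, ← Units.val_mul, ← Units.coe_prod]
    congr 1
    simp only [hχ, MonoidHom.mul_apply, MonoidHom.finsetProd_apply, MonoidHom.inv_apply,
      Finset.prod_mul_distrib]
    congr 1
    · congr 1
      · rw [← Finset.prod_fiberwise univ et]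
        refine Finset.prod_congr rfl fun v _ => Finset.prod_congr rfl fun e he => ?_
        rw [(Finset.mem_filter.1 he).2]
      · rw [← Finset.prod_fiberwise univ eh]
        refine Finset.prod_congr rfl fun v _ => Finset.prod_congr rfl fun e he => ?_
        rw [(Finset.mem_filter.1 he).2]
    · rw [← Finset.prod_fiberwise univ r]
      refine Finset.prod_congr rfl fun v _ => Finset.prod_congr rfl fun e he => ?_
      rw [(Finset.mem_filter.1 he).2]
  simp only [key]
  have h2 := Finset.prod_univ_sum (fun _ : V => (univ : Finset X))
    (fun v x => ((χ v x : ℂˣ) : ℂ))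
  rw [Fintype.piFinset_univ] at h2
  rw [← h2]
  simp only [scaf_charsum, Finset.prod_ite_zero, Finset.prod_const, Finset.card_univ,
    Finset.mem_univ, forall_const]
  rfl

theorem scaf_dual {K V E F : Type*} [CommGroup K] [Finite K] [Fintype V] [Fintype E] [Fintype F]
    [DecidableEq V] [DecidableEq E] [DecidableEq F] (ℓ : ℕ) [NeZero ℓ]
    (eh et : E → V) (fh ft : E → F) (r : Fin ℓ → V) (q : Fin ℓ → F)
    (hGconn : ∀ a b : V, Relation.ReflTransGen
      (fun u w => (∃ e, (et e = u ∧ eh e = w) ∨ (et e = w ∧ eh e = u)) ∨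
        (∃ i : Fin ℓ, (r i = u ∧ r (i + 1) = w) ∨ (r i = w ∧ r (i + 1) = u))) a b)
    (hDconn : ∀ a b : Option F, Relation.ReflTransGen
      (fun u w => (∃ e, (some (ft e) = u ∧ some (fh e) = w) ∨
          (some (ft e) = w ∧ some (fh e) = u)) ∨
        (∃ i : Fin ℓ, ((none : Option F) = u ∧ some (q i) = w) ∨
          (none = w ∧ some (q i) = u))) a b)
    (hcirc : ∀ (μ : Option F → (K)) (v : V),
      ((∏ e ∈ Finset.univ.filter fun e => eh e = v,
          μ (some (fh e)) * (μ (some (ft e)))⁻¹) *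
        ∏ i ∈ Finset.univ.filter fun i : Fin ℓ => r (i + 1) = v,
          μ (some (q i)) * (μ none)⁻¹)⁻¹ *
      ((∏ e ∈ Finset.univ.filter fun e => et e = v,
          μ (some (fh e)) * (μ (some (ft e)))⁻¹) *
        ∏ i ∈ Finset.univ.filter fun i : Fin ℓ => r i = v,
          μ (some (q i)) * (μ none)⁻¹) = 1)
    (hEuler : (Fintype.card V : ℤ) - (Fintype.card E + ℓ) + (Fintype.card F + 1) = 2) (η : Fin ℓ → K) :
    (∀ μ ν : F → K, (∀ e, μ (fh e) * (μ (ft e))⁻¹ = ν (fh e) * (ν (ft e))⁻¹) →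
      (∀ i, μ (q i) = ν (q i)) → μ = ν) ∧
    (∀ ε : E → K, (∀ v, (∏ e ∈ Finset.univ.filter fun e => et e = v, (ε e)⁻¹) *
          (∏ e ∈ Finset.univ.filter fun e => eh e = v, ε e) *
          (∏ i ∈ Finset.univ.filter fun i => r i = v, η (i - 1) * (η i)⁻¹) = 1) ↔
      ∃ μ : F → K, (∀ e, μ (fh e) * (μ (ft e))⁻¹ = ε e) ∧ ∀ i, μ (q i) = η i) := by
  classical
  let hd : E ⊕ Fin ℓ → V := Sum.elim eh (fun i => r (i + 1))
  let tl : E ⊕ Fin ℓ → V := Sum.elim et r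
  let P : (F → K) → (E ⊕ Fin ℓ → K) := fun μ =>
    Sum.elim (fun e => μ (fh e) * (μ (ft e))⁻¹) (fun i => μ (q i))
  have hfil : ∀ (g h : _ → V) (f : E ⊕ Fin ℓ → K) (v : V),
      ∏ x ∈ Finset.univ.filter (fun x => Sum.elim g h x = v), f x =
      (∏ e ∈ Finset.univ.filter (fun e => g e = v), f (Sum.inl e)) *
        ∏ i ∈ Finset.univ.filter (fun i => h i = v), f (Sum.inr i) := by
    intro g h f v
    simp only [Finset.prod_filter, Fintype.prod_sum_type, Sum.elim_inl, Sum.elim_inr]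
    rfl
  have hPker : ∀ μ, P μ ∈ (scafBdry (K := K) hd tl).ker := by
    intro μ
    rw [MonoidHom.mem_ker]
    funext v
    rw [scafBdry_apply, hfil, hfil]
    have h := hcirc (fun o => o.elim 1 μ) v
    simp only [Option.elim_some, Option.elim_none, inv_one, mul_one] at h
    rw [inv_mul_eq_one] at h
    simp only [P, Sum.elim_inl, Sum.elim_inr, Pi.one_apply]
    rw [div_eq_one]
    exact h
  have hPinj : Function.Injective P := by
    intro μ ν h
    have h1 : ∀ e, μ (fh e) * (μ (ft e))⁻¹ = ν (fh e) * (ν (ft e))⁻¹ :=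
      fun e => congrFun h (Sum.inl e)
    have h2 : ∀ i, μ (q i) = ν (q i) := fun i => congrFun h (Sum.inr i)
    have hall : ∀ o : Option F, (o.elim 1 μ : K) = o.elim 1 ν := by
      intro o
      induction hDconn none o with
      | refl => rfl
      | tail _ hstep ih =>
        rcases hstep with ⟨e, ⟨rfl, rfl⟩ | ⟨rfl, rfl⟩⟩ | ⟨i, ⟨rfl, rfl⟩ | ⟨rfl, rfl⟩⟩
        · have := h1 e
          simp only [Option.elim_some] at ih ⊢
          rw [ih] at this
          exact mul_right_cancel this
        · have := h1 e
          simp only [Option.elim_some] at ih ⊢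
          rw [ih] at this
          exact inv_injective (mul_left_cancel this)
        · exact h2 i
        · rfl
    funext f
    exact hall (some f)
  have hGc : ∀ a b : V, Relation.ReflTransGen
      (fun u w => ∃ e, (tl e = u ∧ hd e = w) ∨ (tl e = w ∧ hd e = u)) a b := by
    intro a b
    have := hGconn a b
    revert this
    refine Relation.ReflTransGen.mono ?_ _ _
    rintro u w (⟨e, he⟩ | ⟨i, hi⟩)
    · exact ⟨Sum.inl e, he⟩
    · exact ⟨Sum.inr i, hi⟩
  have hcard := scaf_ker_card (K := K) hd tl (r 0) hGc
  have hKpos : 0 < Nat.card K := Nat.card_pos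
  have hle : Nat.card (scafBdry (K := K) hd tl).ker ≤ Nat.card (F → K) := by
    rw [Nat.card_fun, Nat.card_eq_fintype_card (α := F)]
    refine Nat.le_of_mul_le_mul_right (hcard.trans (le_of_eq ?_))
      (pow_pos hKpos (Fintype.card V))
    rw [← pow_succ, ← pow_add]
    congr 1
    rw [Fintype.card_sum, Fintype.card_fin]
    omega
  have hbij : Function.Bijective
      (fun μ => (⟨P μ, hPker μ⟩ : (scafBdry (K := K) hd tl).ker)) := by
    refine Function.Injective.bijective_of_nat_card_le ?_ hle
    intro μ ν h
    exact hPinj (Subtype.ext_iff.1 h)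
  -- flow condition as circulation
  have hflowiff : ∀ ε : E → K, (∀ v, (∏ e ∈ Finset.univ.filter fun e => et e = v, (ε e)⁻¹) *
          (∏ e ∈ Finset.univ.filter fun e => eh e = v, ε e) *
          (∏ i ∈ Finset.univ.filter fun i => r i = v, η (i - 1) * (η i)⁻¹) = 1) ↔
      (Sum.elim ε η : E ⊕ Fin ℓ → K) ∈ (scafBdry (K := K) hd tl).ker := by
    intro ε
    rw [MonoidHom.mem_ker, funext_iff]
    refine forall_congr' fun v => ?_
    rw [scafBdry_apply, hfil, hfil]
    simp only [Sum.elim_inl, Sum.elim_inr, Pi.one_apply, Finset.prod_mul_distrib,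
      Finset.prod_inv_distrib]
    have hshift : ∏ i ∈ Finset.univ.filter (fun i : Fin ℓ => r (i + 1) = v), η i =
        ∏ i ∈ Finset.univ.filter (fun i : Fin ℓ => r i = v), η (i - 1) := by
      simp only [Finset.prod_filter]
      refine Fintype.prod_equiv (Equiv.addRight 1) _ _ fun i => ?_
      simp
    rw [hshift]
    generalize (∏ e ∈ Finset.univ.filter (fun e => et e = v), ε e) = a
    generalize (∏ e ∈ Finset.univ.filter (fun e => eh e = v), ε e) = b
    generalize (∏ i ∈ Finset.univ.filter (fun i : Fin ℓ => r i = v), η (i - 1)) = s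
    generalize (∏ i ∈ Finset.univ.filter (fun i : Fin ℓ => r i = v), η i) = t
    have : a⁻¹ * b * (s * t⁻¹) = b * s / (a * t) := by
      rw [div_eq_mul_inv, mul_inv]
      simp only [mul_comm, mul_left_comm, mul_assoc]
    rw [this]
  refine ⟨fun μ ν h1 h2 => hPinj ?_, fun ε => (hflowiff ε).trans ⟨fun h => ?_, ?_⟩⟩
  · simp only [P]
    congr 1
    · exact funext h1
    · exact funext h2
  · obtain ⟨μ, hμ⟩ := hbij.2 ⟨_, h⟩
    have hμ' : P μ = Sum.elim ε η := Subtype.ext_iff.1 hμ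
    exact ⟨μ, fun e => congrFun hμ' (Sum.inl e), fun i => congrFun hμ' (Sum.inr i)⟩
  · rintro ⟨μ, h1, h2⟩
    have hP : P μ = Sum.elim ε η := by
      simp only [P]
      congr 1
      · exact funext h1
      · exact funext h2
    rw [← hP]
    exact hPker μ

end Helpers

/-- (Scaffold duality for translation schemes; main theorem.)
Let `(X, R)` be a translation association scheme on a finite abelian group `X`, with
adjacency matrices `(A i) x y = |X|⁻¹ ∑ ε, Pch ε i * conj (ε x) * ε y` (0–1 matrices),
and dual primitive idempotents `(Estar i) ε η = |X|⁻¹ * Pch (η ε⁻¹) i` of the dual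
scheme `(X^*, R^*)`.

Let `S` be a weakly connected standard planar scaffold of order `ℓ ≥ 1`: its digraph
`G` has vertex set `V` (`n = |V|` nodes), edge set `E` (head/tail `eh, et`), distinct
roots `r 1, …, r ℓ` placed clockwise on the boundary circle of a closed disk, and edge
weights `A (lam e)`. The ambient plane graph `G̃` also carries the boundary arcs
`b i : r i → r (i+1)` (`i : Fin ℓ`, cyclically); its faces are the faces `F` inside the
disk together with the unbounded face `∞` (encoded as `(none : Option F)`), the dual of
an interior edge `e` runs from `ft e` to `fh e` (rotation by 90° clockwise), and the
dual of the boundary arc `b i` runs from `∞` to the boundary face `q i` (so `q i` is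
incident with `r i` and `r (i+1)`). The planar structure is encoded by connectivity of
`G̃` and of its dual, the circulation property of face potentials on `G̃`, and Euler's
formula `|V| - (|E| + ℓ) + (|F| + 1) = 2`.

Then `Ψ(S) = |X|^{n - ℓ/2 - 1/2} S†`, where `Ψ` is the isometry with
`Ψ(ε̂) = |X|^{-1/2} ∑_{Φ(η) = ε} η̂` (`Φ η i = η (i-1) * (η i)⁻¹`), and `S†` is the
dual scaffold on the dual digraph, over the dual scheme, with roots `q 1, …, q ℓ` and
weights `Estar (lam e)`: comparing coefficients in the orthonormal basis `η̂` of
`(ℂ^{X^*})^{⊗ℓ} ≅ (ℂ^X)^{⊗ℓ}`, for every `η : Fin ℓ → X^*`,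
`|X|^{-1/2} ⟨(Φη)-hat, S⟩ = |X|^{n - ℓ/2 - 1/2} S†(η)`. -/
theorem stmt_19 (X : Type*) [CommGroup X] [Fintype X] [DecidableEq X]
    [Fintype (X →* ℂˣ)] [DecidableEq (X →* ℂˣ)]
    (V E F : Type*) [Fintype V] [Fintype E] [Fintype F]
    [DecidableEq V] [DecidableEq E] [DecidableEq F]
    (d ℓ : ℕ) [NeZero ℓ] (hl : 1 ≤ ℓ)
    (A : Fin (d + 1) → Matrix X X ℂ)
    (h01 : ∀ i x y, A i x y = 0 ∨ A i x y = 1)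
    (Pch : (X →* ℂˣ) → Fin (d + 1) → ℂ)
    (hA : ∀ (i : Fin (d + 1)) (x y : X), A i x y = (Fintype.card X : ℂ)⁻¹ *
      ∑ ε : X →* ℂˣ, Pch ε i * conj ((ε x : ℂˣ) : ℂ) * ((ε y : ℂˣ) : ℂ))
    (Estar : Fin (d + 1) → Matrix (X →* ℂˣ) (X →* ℂˣ) ℂ)
    (hEstar : ∀ (i : Fin (d + 1)) (ε η : X →* ℂˣ),
      Estar i ε η = (Fintype.card X : ℂ)⁻¹ * Pch (η * ε⁻¹) i)
    (eh et : E → V) (fh ft : E → F) (lam : E → Fin (d + 1))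
    (r : Fin ℓ → V) (hr : Function.Injective r)
    (q : Fin ℓ → F) (hq : Function.Injective q)
    (hGconn : ∀ a b : V, Relation.ReflTransGen
      (fun u w => (∃ e, (et e = u ∧ eh e = w) ∨ (et e = w ∧ eh e = u)) ∨
        (∃ i : Fin ℓ, (r i = u ∧ r (i + 1) = w) ∨ (r i = w ∧ r (i + 1) = u))) a b)
    (hDconn : ∀ a b : Option F, Relation.ReflTransGen
      (fun u w => (∃ e, (some (ft e) = u ∧ some (fh e) = w) ∨
          (some (ft e) = w ∧ some (fh e) = u)) ∨
        (∃ i : Fin ℓ, ((none : Option F) = u ∧ some (q i) = w) ∨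
          (none = w ∧ some (q i) = u))) a b)
    (hcirc : ∀ (μ : Option F → (X →* ℂˣ)) (v : V),
      ((∏ e ∈ Finset.univ.filter fun e => eh e = v,
          μ (some (fh e)) * (μ (some (ft e)))⁻¹) *
        ∏ i ∈ Finset.univ.filter fun i : Fin ℓ => r (i + 1) = v,
          μ (some (q i)) * (μ none)⁻¹)⁻¹ *
      ((∏ e ∈ Finset.univ.filter fun e => et e = v,
          μ (some (fh e)) * (μ (some (ft e)))⁻¹) *
        ∏ i ∈ Finset.univ.filter fun i : Fin ℓ => r i = v,
          μ (some (q i)) * (μ none)⁻¹) = 1)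
    (hEuler : (Fintype.card V : ℤ) - (Fintype.card E + ℓ) + (Fintype.card F + 1) = 2)
    (Sc : (Fin ℓ → X) → ℂ)
    (hSc : ∀ xv, Sc xv = ∑ σ : V → X,
      (∏ e, A (lam e) (σ (et e)) (σ (eh e))) *
        ∏ i, (if σ (r i) = xv i then (1 : ℂ) else 0))
    (Sd : (Fin ℓ → (X →* ℂˣ)) → ℂ)
    (hSd : ∀ ηv, Sd ηv = ∑ μ : F → (X →* ℂˣ),
      (∏ e, Estar (lam e) (μ (ft e)) (μ (fh e))) *
        ∏ i, (if μ (q i) = ηv i then (1 : ℂ) else 0)) :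
    ∀ η : Fin ℓ → (X →* ℂˣ),
      (Real.sqrt (Fintype.card X) : ℂ)⁻¹ *
        ∑ xv : Fin ℓ → X,
          (∏ i, (Real.sqrt (Fintype.card X) : ℂ)⁻¹ *
            (((η (i - 1) * (η i)⁻¹) (xv i) : ℂˣ) : ℂ)) * Sc xv =
      (((Fintype.card X : ℝ) ^
          ((Fintype.card V : ℝ) - (ℓ : ℝ) / 2 - 1 / 2) : ℝ) : ℂ) * Sd η := by
  intro η
  classical
  set m : ℂ := (Fintype.card X : ℂ) with hm
  set c : ℂ := (Real.sqrt (Fintype.card X) : ℂ)⁻¹ with hc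
  have hm0 : m ≠ 0 := by rw [hm]; exact_mod_cast Fintype.card_ne_zero
  set κ : Fin ℓ → (X →* ℂˣ) := fun i => η (i - 1) * (η i)⁻¹ with hκ
  set flow : (E → (X →* ℂˣ)) → Prop := fun ε =>
    ∀ v, (∏ e ∈ Finset.univ.filter fun e => et e = v, (ε e)⁻¹) *
          (∏ e ∈ Finset.univ.filter fun e => eh e = v, ε e) *
          (∏ i ∈ Finset.univ.filter fun i => r i = v, κ i) = 1 with hflow
  -- left-hand side
  have hL1 : ∑ xv : Fin ℓ → X, (∏ i, c * ((κ i (xv i) : ℂˣ) : ℂ)) * Sc xv =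
      c ^ ℓ * ∑ σ : V → X, (∏ e, A (lam e) (σ (et e)) (σ (eh e))) *
        ∏ i, ((κ i (σ (r i)) : ℂˣ) : ℂ) := by
    simp only [hSc, Finset.mul_sum]
    rw [Finset.sum_comm]
    refine Finset.sum_congr rfl fun σ _ => ?_
    rw [Finset.sum_eq_single (fun i => σ (r i))]
    · simp [Finset.prod_mul_distrib]
      ring
    · intro xv _ hne
      have : ∃ i, σ (r i) ≠ xv i := by
        by_contra hcon
        push Not at hcon
        exact hne (funext fun i => (hcon i).symm)
      obtain ⟨i, hi⟩ := this
      rw [Finset.prod_eq_zero (s := Finset.univ) (i := i)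
        (f := fun i => if σ (r i) = xv i then (1 : ℂ) else 0) (Finset.mem_univ i) (if_neg hi)]
      simp
    · simp
  have hL2 : ∑ σ : V → X, (∏ e, A (lam e) (σ (et e)) (σ (eh e))) *
        ∏ i, ((κ i (σ (r i)) : ℂˣ) : ℂ) =
      m⁻¹ ^ Fintype.card E * m ^ Fintype.card V *
        ∑ ε : E → (X →* ℂˣ), if flow ε then ∏ e, Pch (ε e) (lam e) else 0 := by
    have hexp : ∀ σ : V → X, (∏ e, A (lam e) (σ (et e)) (σ (eh e))) =
        m⁻¹ ^ Fintype.card E * ∑ ε : E → (X →* ℂˣ), (∏ e, Pch (ε e) (lam e)) *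
          ∏ e, conj ((ε e (σ (et e)) : ℂˣ) : ℂ) * ((ε e (σ (eh e)) : ℂˣ) : ℂ) := by
      intro σ
      simp only [hA, Finset.prod_mul_distrib, Finset.prod_const, Finset.card_univ]
      congr 1
      have h2 := Finset.prod_univ_sum (fun _ : E => (Finset.univ : Finset (X →* ℂˣ)))
        (fun e χ => Pch χ (lam e) * conj ((χ (σ (et e)) : ℂˣ) : ℂ) *
          ((χ (σ (eh e)) : ℂˣ) : ℂ))
      rw [Fintype.piFinset_univ] at h2
      rw [h2]
      refine Finset.sum_congr rfl fun ε _ => ?_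
      simp only [Finset.prod_mul_distrib, mul_assoc]
    simp only [hexp, mul_assoc, Finset.sum_mul, ← Finset.mul_sum]
    congr 1
    rw [Finset.sum_comm, Finset.mul_sum]
    refine Finset.sum_congr rfl fun ε _ => ?_
    rw [← Finset.mul_sum, scaf_sigma]
    by_cases hf : flow ε
    · rw [if_pos hf, if_pos hf, mul_comm]
    · rw [if_neg hf, if_neg hf]; simp
  -- right-hand side
  have hR : Sd η = m⁻¹ ^ Fintype.card E *
      ∑ μ : F → (X →* ℂˣ), if (∀ i, μ (q i) = η i) then
        ∏ e, Pch (μ (fh e) * (μ (ft e))⁻¹) (lam e) else 0 := by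
    rw [hSd, Finset.mul_sum]
    refine Finset.sum_congr rfl fun μ _ => ?_
    simp only [hEstar, Finset.prod_mul_distrib, Finset.prod_const, Finset.card_univ,
      Finset.prod_ite_zero, Finset.mem_univ, true_imp_iff, one_pow]
    split_ifs <;> simp
  -- planar duality
  obtain ⟨hinj, hfl⟩ := scaf_dual (K := X →* ℂˣ) ℓ eh et fh ft r q hGconn hDconn hcirc hEuler η
  have hsum : (∑ ε : E → (X →* ℂˣ), if flow ε then ∏ e, Pch (ε e) (lam e) else 0) =
      ∑ μ : F → (X →* ℂˣ), if (∀ i, μ (q i) = η i) then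
        ∏ e, Pch (μ (fh e) * (μ (ft e))⁻¹) (lam e) else 0 := by
    rw [← Finset.sum_filter, ← Finset.sum_filter]
    symm
    refine Finset.sum_bij (fun μ _ => fun e => μ (fh e) * (μ (ft e))⁻¹) ?_ ?_ ?_ ?_
    · intro μ hμ
      rw [Finset.mem_filter] at hμ ⊢
      exact ⟨Finset.mem_univ _, (hfl _).2 ⟨μ, fun _ => rfl, hμ.2⟩⟩
    · intro μ hμ ν hν h
      rw [Finset.mem_filter] at hμ hν
      exact hinj μ ν (fun e => congrFun h e) fun i => (hμ.2 i).trans (hν.2 i).symm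
    · intro ε hε
      rw [Finset.mem_filter] at hε
      obtain ⟨μ, h1, h2⟩ := (hfl ε).1 hε.2
      exact ⟨μ, Finset.mem_filter.2 ⟨Finset.mem_univ _, h2⟩, funext h1⟩
    · intro μ _
      rfl
  -- constants
  have hconst : (((Fintype.card X : ℝ) ^
      ((Fintype.card V : ℝ) - (ℓ : ℝ) / 2 - 1 / 2) : ℝ) : ℂ) =
      c * c ^ ℓ * m ^ Fintype.card V := by
    have hpos : (0 : ℝ) < Fintype.card X := by exact_mod_cast Fintype.card_pos
    have hreal : (Fintype.card X : ℝ) ^ ((Fintype.card V : ℝ) - (ℓ : ℝ) / 2 - 1 / 2) =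
        (Real.sqrt (Fintype.card X))⁻¹ * (Real.sqrt (Fintype.card X))⁻¹ ^ ℓ *
          (Fintype.card X : ℝ) ^ Fintype.card V := by
      have hs : (Real.sqrt (Fintype.card X))⁻¹ = (Fintype.card X : ℝ) ^ (-(1 / 2) : ℝ) := by
        rw [Real.sqrt_eq_rpow, Real.rpow_neg hpos.le]
      rw [hs, ← Real.rpow_natCast, ← Real.rpow_natCast, ← Real.rpow_mul hpos.le,
        ← Real.rpow_add hpos, ← Real.rpow_add hpos]
      congr 1
      ring
    rw [hreal, hc, hm]
    push_cast
    ring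
  rw [hL1, hL2, hsum, hR, hconst]
  ring
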